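/- Let π and π' be groups with normal subgroups Γ ⊴ π and Γ' ⊴ π', with relative lower central series Γ_k and Γ'_k respectively, and let n ≥ 2. Suppose ψ̃ : π'/Γ'_{n+1} → π/Γ_{n+1} and ψ̃' : π/Γ_{n+1} → π'/Γ'_{n+1} are group homomorphisms such that: for every x ∈ π'/Γ'_{n+1}, the element (ψ̃' ∘ ψ̃)(x)·x⁻¹ lies in the image of Γ'_n in π'/Γ'_{n+1}, and for every y ∈ π/Γ_{n+1}, the element (ψ̃ ∘ ψ̃')(y)·y⁻¹ lies in the image of Γ_n in π/Γ_{n+1} (i.e., the two composites descend to the identity maps of π'/Γ'_n and π/Γ_n respectively). Then ψ̃ and ψ̃' are both bijective, hence give isomorphisms π'/Γ'_{n+1} ≅ π/Γ_{n+1}. (This is the paper's conclusion in the proof of Theorem 7.1 that the lift ψ̃ of an n-level isomorphism, together with a lift ψ̃' of its inverse, is an isomorphism of (n+1)-st relative lower central quotients.) -/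

import Mathlib

/-- An endomorphism that moves each element by an element of a central commutator subgroup
`⁅⊤, M⁆` is bijective, since it fixes `⁅⊤, M⁆` pointwise. -/
theorem MonoidHom.bijective_of_mul_inv_mem_central_commutator {G : Type*} [Group G]
    (f : G →* G) (M : Subgroup G) (hM : ⁅(⊤ : Subgroup G), M⁆ ≤ Subgroup.center G)
    (hf : ∀ x, f x * x⁻¹ ∈ ⁅(⊤ : Subgroup G), M⁆) : Function.Bijective f := by
  have hfix : ∀ z ∈ ⁅(⊤ : Subgroup G), M⁆, f z = z := by
    suffices h : ⁅(⊤ : Subgroup G), M⁆ ≤ f.eqLocus (MonoidHom.id G) from fun z hz => h hz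
    rw [Subgroup.commutator_le]
    intro a _ b _
    have ha := Subgroup.mem_center_iff.mp (hM (hf a))
    have hb := Subgroup.mem_center_iff.mp (hM (hf b))
    change f (a * b * a⁻¹ * b⁻¹) = a * b * a⁻¹ * b⁻¹
    obtain ⟨u, hu⟩ : ∃ u, u = f a * a⁻¹ := ⟨_, rfl⟩
    obtain ⟨v, hv⟩ : ∃ v, v = f b * b⁻¹ := ⟨_, rfl⟩
    rw [← hu] at ha
    rw [← hv] at hb
    have hfa : f a = u * a := by simp [hu]
    have hfb : f b = v * b := by simp [hv]
    rw [map_mul, map_mul, map_mul, map_inv, map_inv, hfa, hfb]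
    calc u * a * (v * b) * (u * a)⁻¹ * (v * b)⁻¹
        = u * (a * v) * b * a⁻¹ * u⁻¹ * b⁻¹ * v⁻¹ := by group
      _ = u * (v * a) * b * a⁻¹ * u⁻¹ * b⁻¹ * v⁻¹ := by rw [hb]
      _ = (u * v) * (a * b * a⁻¹ * u⁻¹ * b⁻¹ * v⁻¹) := by group
      _ = (v * u) * (a * b * a⁻¹ * u⁻¹ * b⁻¹ * v⁻¹) := by rw [hb]
      _ = v * (u * (a * b * a⁻¹)) * u⁻¹ * b⁻¹ * v⁻¹ := by group
      _ = v * ((a * b * a⁻¹) * u) * u⁻¹ * b⁻¹ * v⁻¹ := by rw [ha]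
      _ = v * (a * b * a⁻¹ * b⁻¹) * v⁻¹ := by group
      _ = (a * b * a⁻¹ * b⁻¹) * v * v⁻¹ := by rw [hb]
      _ = a * b * a⁻¹ * b⁻¹ := by group
  constructor
  · rw [injective_iff_map_eq_one]
    intro x hx
    have h := hf x
    rw [hx, one_mul, inv_mem_iff] at h
    rw [← hfix x h, hx]
  · intro x
    refine ⟨(f x * x⁻¹)⁻¹ * x, ?_⟩
    rw [map_mul, map_inv, hfix _ (hf x)]
    group

/-- An endomorphism of `G ⧸ γ (n + 1)` inducing the identity modulo `γ n` is bijective, where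
`γ` is a relative lower central series and `2 ≤ n`. -/
theorem MonoidHom.bijective_of_descends_to_id {G : Type*} [Group G] (γ : ℕ → Subgroup G)
    (hγ : ∀ k ≥ 1, γ (k + 1) = ⁅(⊤ : Subgroup G), γ k⁆) (n : ℕ) (hn : 2 ≤ n)
    [(γ (n + 1)).Normal] (f : (G ⧸ γ (n + 1)) →* (G ⧸ γ (n + 1)))
    (hf : ∀ x, f x * x⁻¹ ∈ (γ n).map (QuotientGroup.mk' (γ (n + 1)))) :
    Function.Bijective f := by
  have hmap : ∀ k ≥ 1, (γ (k + 1)).map (QuotientGroup.mk' (γ (n + 1))) =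
      ⁅(⊤ : Subgroup (G ⧸ γ (n + 1))), (γ k).map (QuotientGroup.mk' (γ (n + 1)))⁆ := by
    intro k hk
    rw [hγ k hk, Subgroup.map_commutator,
      Subgroup.map_top_of_surjective _ (QuotientGroup.mk'_surjective _)]
  have hcenter : (γ n).map (QuotientGroup.mk' (γ (n + 1))) ≤ Subgroup.center _ := by
    have h := hmap n (by lia)
    rw [QuotientGroup.map_mk'_self, eq_comm, Subgroup.commutator_comm,
      Subgroup.commutator_eq_bot_iff_le_centralizer] at h
    simpa [Subgroup.centralizer_univ] using h
  obtain ⟨m, rfl⟩ : ∃ m, n = m + 1 := ⟨n - 1, by lia⟩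
  have hm := hmap m (by lia)
  rw [hm] at hcenter
  exact f.bijective_of_mul_inv_mem_central_commutator _ hcenter fun x => hm ▸ hf x


/-- For `n ≥ 2`, if `ψ : π'/Γ'_{n+1} → π/Γ_{n+1}` and
`ψ' : π/Γ_{n+1} → π'/Γ'_{n+1}` are homomorphisms whose two composites descend to the
identity maps of `π'/Γ'_n` and `π/Γ_n` respectively, then `ψ` and `ψ'` are both
bijective, hence give isomorphisms `π'/Γ'_{n+1} ≅ π/Γ_{n+1}`. -/
theorem relative_lcs_mutual_lifts_are_isomorphisms
    {π π' : Type*} [Group π] [Group π']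
    (Γ : Subgroup π) [Γ.Normal] (Γ' : Subgroup π') [Γ'.Normal]
    (γ : ℕ → Subgroup π) (hγ1 : γ 1 = Γ)
    (hγ : ∀ k ≥ 1, γ (k + 1) = ⁅(⊤ : Subgroup π), γ k⁆)
    (γ' : ℕ → Subgroup π') (hγ'1 : γ' 1 = Γ')
    (hγ' : ∀ k ≥ 1, γ' (k + 1) = ⁅(⊤ : Subgroup π'), γ' k⁆)
    (n : ℕ) (hn : 2 ≤ n)
    [instN : (γ (n + 1)).Normal] [instN' : (γ' (n + 1)).Normal]
    (ψ : (π' ⧸ γ' (n + 1)) →* (π ⧸ γ (n + 1)))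
    (ψ' : (π ⧸ γ (n + 1)) →* (π' ⧸ γ' (n + 1)))
    (h1 : ∀ x, ψ' (ψ x) * x⁻¹ ∈ (γ' n).map (QuotientGroup.mk' (γ' (n + 1))))
    (h2 : ∀ y, ψ (ψ' y) * y⁻¹ ∈ (γ n).map (QuotientGroup.mk' (γ (n + 1)))) :
    Function.Bijective ψ ∧ Function.Bijective ψ' := by
  have h := (ψ'.comp ψ).bijective_of_descends_to_id γ' hγ' n hn h1
  have h' := (ψ.comp ψ').bijective_of_descends_to_id γ hγ n hn h2
  rw [MonoidHom.coe_comp] at h h'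
  exact ⟨⟨h.1.of_comp, h'.2.of_comp⟩, ⟨h'.1.of_comp, h.2.of_comp⟩⟩
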